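/- Let H ∈ (0,1) and a > 0, let K_H be the Volterra kernel of the Mandelbrot–Van Ness fractional Brownian motion, and for ε ∈ (0,1] let K^ε(t,s) = ε^H K_H(t,s) − a ε^{H+1} ∫_s^t e^{−aε(t−u)} K_H(u,s) du for 0 < s < t ≤ 1 (and 0 for s ≥ t). Then sup_{s,t ∈ [0,1]} | ε^{−2H} ∫_0^{min(s,t)} K^ε(t,u) K^ε(s,u) du − ∫_0^{min(s,t)} K_H(t,u) K_H(s,u) du | → 0 as ε → 0⁺. -/

import Mathlib

open Real Filter Set MeasureTheory

/-- Normalizing constant of the Mandelbrot–Van Ness Volterra kernel. -/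
noncomputable def cH (H : ℝ) : ℝ :=
  Real.sqrt (2 * H * Real.Gamma (3 / 2 - H) / (Real.Gamma (H + 1 / 2) * Real.Gamma (2 - 2 * H)))

/-- The Volterra kernel of the Mandelbrot–Van Ness fractional Brownian motion,
extended by `0` for `s ≥ t`. -/
noncomputable def KH (H t s : ℝ) : ℝ :=
  if s < t then
    cH H * ((t / s) ^ (H - 1 / 2) * (t - s) ^ (H - 1 / 2)
      - (H - 1 / 2) * s ^ (1 / 2 - H) * ∫ u in s..t, u ^ (H - 3 / 2) * (u - s) ^ (H - 1 / 2))
  else 0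

/-- The short-time rescaled kernel of the fractional Ornstein–Uhlenbeck process,
extended by `0` for `s ≥ t`. -/
noncomputable def KepsFOU (H a ε t s : ℝ) : ℝ :=
  if s < t then
    ε ^ H * KH H t s - a * ε ^ (H + 1) * ∫ u in s..t, Real.exp (-(a * ε * (t - u))) * KH H u s
  else 0

/-- Interval integrals with measurable endpoints and integrand depend measurably on a parameter. -/
theorem measurable_intervalIntegral_of_measurable {X : Type*} [MeasurableSpace X]
    {f : X → ℝ → ℝ} {l r : X → ℝ} (hf : Measurable (Function.uncurry f))
    (hl : Measurable l) (hr : Measurable r) :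
    Measurable fun x => ∫ u in (l x)..(r x), f x u := by
  have key : ∀ {l r : X → ℝ}, Measurable l → Measurable r →
      Measurable fun x => ∫ u in Set.Ioc (l x) (r x), f x u := by
    intro l r hl hr
    have hset : MeasurableSet {p : X × ℝ | l p.1 < p.2 ∧ p.2 ≤ r p.1} :=
      (measurableSet_lt (hl.comp measurable_fst) measurable_snd).inter
        (measurableSet_le measurable_snd (hr.comp measurable_fst))
    have h := (hf.indicator hset).stronglyMeasurable.integral_prod_right' (ν := volume)
    convert h.measurable using 2 with x
    rw [← integral_indicator measurableSet_Ioc]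
    rfl
  simp only [intervalIntegral]
  exact (key hl hr).sub (key hr hl)

theorem measurable_KH (H : ℝ) : Measurable fun p : ℝ × ℝ => KH H p.1 p.2 := by
  unfold KH
  refine Measurable.ite (measurableSet_lt measurable_snd measurable_fst) ?_ measurable_const
  have hI : Measurable fun p : ℝ × ℝ =>
      ∫ u in p.2..p.1, u ^ (H - 3 / 2) * (u - p.2) ^ (H - 1 / 2) := by
    refine measurable_intervalIntegral_of_measurable
      (f := fun (p : ℝ × ℝ) u => u ^ (H - 3 / 2) * (u - p.2) ^ (H - 1 / 2)) ?_
      measurable_snd measurable_fst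
    simp only [Function.uncurry_def]
    fun_prop
  fun_prop

theorem measurable_integral_exp_mul_KH (H b t : ℝ) :
    Measurable fun s => ∫ u in s..t, Real.exp (-(b * (t - u))) * KH H u s := by
  refine measurable_intervalIntegral_of_measurable
    (f := fun s u => Real.exp (-(b * (t - u))) * KH H u s) ?_ measurable_id measurable_const
  have h : Measurable fun p : ℝ × ℝ => KH H p.2 p.1 := (measurable_KH H).comp measurable_swap
  simp only [Function.uncurry_def]
  fun_prop

theorem integral_sub_rpow_of_le {s t p : ℝ} (hp : -1 < p) :
    IntervalIntegrable (fun u => (u - s) ^ p) volume s t ∧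
      ∫ u in s..t, (u - s) ^ p = (t - s) ^ (p + 1) / (p + 1) := by
  constructor
  · have h := (intervalIntegral.intervalIntegrable_rpow' (a := 0) (b := t - s) hp).comp_sub_right s
    simpa using h
  · rw [intervalIntegral.integral_comp_sub_right (fun x => x ^ p), integral_rpow (Or.inl hp)]
    simp [Real.zero_rpow (by linarith : p + 1 ≠ 0)]

/-- The Volterra kernel is dominated by negative powers of the distances to the endpoints. -/
theorem exists_abs_KH_le {H δ : ℝ} (h₁ : H - 1 / 2 < δ) (h₂ : -(H - 1 / 2) < δ) (hδ : δ < 1 / 2) :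
    ∃ C, 0 ≤ C ∧ ∀ s t, 0 < s → s < t → t ≤ 1 →
      |KH H t s| ≤ C * (s ^ (-δ) + (t - s) ^ (-δ)) := by
  obtain ⟨α, hα⟩ : ∃ α, α = H - 1 / 2 := ⟨_, rfl⟩
  rw [← hα] at h₁ h₂
  have hδ0 : 0 < δ := by linarith
  have hp : 0 < α + δ := by linarith
  have hc : 0 ≤ cH H := Real.sqrt_nonneg _
  refine ⟨cH H * (1 + |α| / (α + δ)), by positivity, ?_⟩
  intro s t hs hst ht
  have hts : 0 < t - s := by linarith
  have ht0 : 0 < t := by linarith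
  have hfirst : (t / s) ^ α * (t - s) ^ α ≤ s ^ (-δ) + (t - s) ^ (-δ) := by
    have hsδ : 0 ≤ s ^ (-δ) := by positivity
    have htsδ : 0 ≤ (t - s) ^ (-δ) := by positivity
    have h1 : 1 ≤ t / s := by rw [le_div_iff₀ hs]; linarith
    rcases le_total 0 α with h0 | h0
    · have e1 : (t / s) ^ α ≤ s ^ (-δ) := by
        calc (t / s) ^ α ≤ (t / s) ^ δ := Real.rpow_le_rpow_of_exponent_le h1 h₁.le
          _ ≤ (1 / s) ^ δ := by gcongr
          _ = s ^ (-δ) := by rw [one_div, Real.inv_rpow hs.le, Real.rpow_neg hs.le]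
      have e2 : (t - s) ^ α ≤ 1 := Real.rpow_le_one hts.le (by linarith) h0
      have e3 := mul_le_mul e1 e2 (by positivity) hsδ
      linarith
    · have e1 : (t / s) ^ α ≤ 1 := Real.rpow_le_one_of_one_le_of_nonpos h1 h0
      have e2 : (t - s) ^ α ≤ (t - s) ^ (-δ) :=
        Real.rpow_le_rpow_of_exponent_ge hts (by linarith) (by linarith)
      have e3 := mul_le_mul e1 e2 (by positivity) zero_le_one
      linarith
  have hint : |∫ u in s..t, u ^ (α - 1) * (u - s) ^ α| ≤ s ^ (-(δ - α)) * (1 / (α + δ)) := by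
    obtain ⟨hi, he⟩ := integral_sub_rpow_of_le (s := s) (t := t) (p := α + δ - 1) (by linarith)
    have hb : ∀ᵐ u, u ∈ Set.Ioc s t →
        ‖u ^ (α - 1) * (u - s) ^ α‖ ≤ s ^ (-(δ - α)) * (u - s) ^ (α + δ - 1) := by
      refine Filter.Eventually.of_forall fun u hu => ?_
      have hus : 0 < u - s := by linarith [hu.1]
      have hu0 : 0 < u := by linarith [hu.1]
      rw [Real.norm_of_nonneg (by positivity)]
      have e0 : u ^ (α - 1) = u ^ (-(δ - α)) * u ^ (-(1 - δ)) := by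
        rw [← Real.rpow_add hu0]; ring_nf
      have e1 : (u - s) ^ (α + δ - 1) = (u - s) ^ (-(1 - δ)) * (u - s) ^ α := by
        rw [← Real.rpow_add hus]; ring_nf
      rw [e0, e1, ← mul_assoc]
      have e2 : u ^ (-(δ - α)) ≤ s ^ (-(δ - α)) :=
        Real.rpow_le_rpow_of_nonpos hs hu.1.le (by linarith)
      have e3 : u ^ (-(1 - δ)) ≤ (u - s) ^ (-(1 - δ)) :=
        Real.rpow_le_rpow_of_nonpos hus (by linarith) (by linarith)
      gcongr
    have h := intervalIntegral.norm_integral_le_of_norm_le hst.le hb (hi.const_mul _)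
    rw [intervalIntegral.integral_const_mul, he] at h
    refine h.trans ?_
    have e : (t - s) ^ (α + δ - 1 + 1) ≤ 1 :=
      Real.rpow_le_one hts.le (by linarith) (by linarith)
    rw [show α + δ - 1 + 1 = α + δ by ring] at e ⊢
    gcongr
  have hsecond : |α * s ^ (-α) * ∫ u in s..t, u ^ (α - 1) * (u - s) ^ α| ≤
      |α| / (α + δ) * s ^ (-δ) := by
    rw [abs_mul, abs_mul, abs_of_pos (Real.rpow_pos_of_pos hs (-α))]
    calc _ ≤ |α| * s ^ (-α) * (s ^ (-(δ - α)) * (1 / (α + δ))) := by gcongr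
      _ = |α| / (α + δ) * (s ^ (-α) * s ^ (-(δ - α))) := by ring
      _ = _ := by rw [← Real.rpow_add hs]; ring_nf
  have hrw : KH H t s = cH H * ((t / s) ^ α * (t - s) ^ α
      - α * s ^ (-α) * ∫ u in s..t, u ^ (α - 1) * (u - s) ^ α) := by
    rw [KH, if_pos hst, hα, show H - 1 / 2 - 1 = H - 3 / 2 by ring,
      show -(H - 1 / 2) = 1 / 2 - H by ring]
  rw [hrw, abs_mul, abs_of_nonneg hc]
  refine (mul_le_mul_of_nonneg_left ?_ hc).trans_eq (mul_assoc _ _ _).symm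
  refine (abs_sub (_ : ℝ) _).trans ?_
  rw [abs_of_nonneg (by positivity : 0 ≤ (t / s) ^ α * (t - s) ^ α)]
  have hpos : 0 ≤ |α| / (α + δ) * (t - s) ^ (-δ) := by positivity
  linarith

theorem abs_integral_exp_mul_KH_le {H δ C : ℝ} (hδ0 : 0 < δ) (hδ : δ < 1 / 2) (hC : 0 ≤ C)
    (hK : ∀ s t, 0 < s → s < t → t ≤ 1 → |KH H t s| ≤ C * (s ^ (-δ) + (t - s) ^ (-δ)))
    {b : ℝ} (hb : 0 ≤ b) {s t : ℝ} (hs : 0 < s) (hst : s < t) (ht : t ≤ 1) :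
    |∫ u in s..t, Real.exp (-(b * (t - u))) * KH H u s| ≤
      3 * C * (s ^ (-δ) + (t - s) ^ (-δ)) := by
  have hts : 0 < t - s := by linarith
  obtain ⟨hi, he⟩ := integral_sub_rpow_of_le (s := s) (t := t) (p := -δ) (by linarith)
  have hbd : ∀ᵐ u, u ∈ Set.Ioc s t → ‖Real.exp (-(b * (t - u))) * KH H u s‖ ≤
      C * (s ^ (-δ) + (u - s) ^ (-δ)) := by
    refine Filter.Eventually.of_forall fun u hu => ?_
    rw [norm_mul, Real.norm_eq_abs, Real.abs_exp, Real.norm_eq_abs]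
    have e1 : Real.exp (-(b * (t - u))) ≤ 1 :=
      Real.exp_le_one_iff.2 (by have := mul_nonneg hb (sub_nonneg.2 hu.2); linarith)
    calc _ ≤ 1 * |KH H u s| := by gcongr
      _ ≤ _ := by rw [one_mul]; exact hK s u hs hu.1 (hu.2.trans ht)
  have h := intervalIntegral.norm_integral_le_of_norm_le hst.le hbd
    ((intervalIntegrable_const.add hi).const_mul C)
  rw [intervalIntegral.integral_const_mul, intervalIntegral.integral_add intervalIntegrable_const hi,
    he, intervalIntegral.integral_const, smul_eq_mul, Real.norm_eq_abs] at h
  refine h.trans ?_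
  have hs1 : 1 ≤ s ^ (-δ) :=
    Real.one_le_rpow_of_pos_of_le_one_of_nonpos hs (by linarith) (by linarith)
  have e1 : (t - s) * s ^ (-δ) ≤ 1 * s ^ (-δ) := by gcongr; linarith
  have e2 : (t - s) ^ (-δ + 1) / (-δ + 1) ≤ 2 := by
    rw [div_le_iff₀ (by linarith)]
    have : (t - s) ^ (-δ + 1) ≤ 1 := Real.rpow_le_one hts.le (by linarith) (by linarith)
    linarith
  have e3 : 0 ≤ (t - s) ^ (-δ) := by positivity
  have : (t - s) * s ^ (-δ) + (t - s) ^ (-δ + 1) / (-δ + 1) ≤ 3 * (s ^ (-δ) + (t - s) ^ (-δ)) := by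
    linarith
  calc _ ≤ C * (3 * (s ^ (-δ) + (t - s) ^ (-δ))) := by gcongr
    _ = _ := by ring

/-- Square integrability of the dominating function, with a bound uniform in the length. -/
theorem integral_sq_rpow_add_rpow_le {δ m : ℝ} (hδ : δ < 1 / 2)
    (hm0 : 0 ≤ m) (hm : m ≤ 1) :
    IntervalIntegrable (fun u => (u ^ (-δ) + (m - u) ^ (-δ)) ^ 2) volume 0 m ∧
      ∫ u in (0:ℝ)..m, (u ^ (-δ) + (m - u) ^ (-δ)) ^ 2 ≤ 4 / (1 - 2 * δ) := by
  obtain ⟨hi, he⟩ := integral_sub_rpow_of_le (s := 0) (t := m) (p := -(2 * δ)) (by linarith)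
  simp only [sub_zero] at hi he
  have hi' : IntervalIntegrable (fun u => (m - u) ^ (-(2 * δ))) volume 0 m := by
    have h := hi.comp_sub_left m
    simpa using h.symm
  have he' : ∫ u in (0:ℝ)..m, (m - u) ^ (-(2 * δ)) = m ^ (-(2 * δ) + 1) / (-(2 * δ) + 1) := by
    rw [intervalIntegral.integral_comp_sub_left (fun x => x ^ (-(2 * δ)))]
    simpa using he
  have hsq : ∀ x : ℝ, 0 < x → x ^ (-(2 * δ)) = (x ^ (-δ)) ^ 2 := fun x hx => by
    rw [sq, ← Real.rpow_add hx]; ring_nf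
  have hdom := (hi.add hi').const_mul 2
  have hle : ∀ u ∈ Set.Ioo 0 m, (u ^ (-δ) + (m - u) ^ (-δ)) ^ 2 ≤
      2 * (u ^ (-(2 * δ)) + (m - u) ^ (-(2 * δ))) := by
    intro u hu
    rw [hsq u hu.1, hsq (m - u) (by linarith [hu.2])]
    nlinarith [sq_nonneg (u ^ (-δ) - (m - u) ^ (-δ))]
  have hint : IntervalIntegrable (fun u => (u ^ (-δ) + (m - u) ^ (-δ)) ^ 2) volume 0 m := by
    rw [intervalIntegrable_iff_integrableOn_Ioo_of_le hm0] at hdom ⊢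
    refine Integrable.mono' hdom (by fun_prop) ?_
    filter_upwards [ae_restrict_mem measurableSet_Ioo] with u hu
    rw [Real.norm_of_nonneg (sq_nonneg _)]
    exact hle u hu
  refine ⟨hint, ?_⟩
  refine (intervalIntegral.integral_mono_on_of_le_Ioo hm0 hint hdom hle).trans ?_
  rw [intervalIntegral.integral_const_mul, intervalIntegral.integral_add hi hi', he, he']
  have : m ^ (-(2 * δ) + 1) ≤ 1 := Real.rpow_le_one hm0 hm (by linarith)
  have h2 : m ^ (-(2 * δ) + 1) / (-(2 * δ) + 1) ≤ 1 / (1 - 2 * δ) := by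
    rw [show -(2 * δ) + 1 = 1 - 2 * δ by ring] at this ⊢
    have : 0 < 1 - 2 * δ := by linarith
    gcongr
  calc _ ≤ 2 * (1 / (1 - 2 * δ) + 1 / (1 - 2 * δ)) := by gcongr
    _ = _ := by ring

/-- The covariances of the rescaled fOU process and of fBm differ by at most `O(ε)`,
uniformly on the unit square. -/
theorem exists_abs_covariance_sub_le {H a : ℝ} (hH : H ∈ Set.Ioo (0:ℝ) 1) (ha : 0 < a) :
    ∃ M, 0 ≤ M ∧ ∀ ε ∈ Set.Ioc (0:ℝ) 1, ∀ t ∈ Set.Icc (0:ℝ) 1, ∀ s ∈ Set.Icc (0:ℝ) 1,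
      |(∫ u in (0:ℝ)..(min s t), KH H t u * KH H s u) -
        ε ^ (-(2 * H)) * ∫ u in (0:ℝ)..(min s t), KepsFOU H a ε t u * KepsFOU H a ε s u| ≤
          M * ε := by
  obtain ⟨δ, h1, h2⟩ : ∃ δ, |H - 1 / 2| < δ ∧ δ < 1 / 2 :=
    exists_between (abs_lt.2 ⟨by linarith [hH.1], by linarith [hH.2]⟩)
  have hδ0 : 0 < δ := (abs_nonneg _).trans_lt h1
  obtain ⟨C, hC, hK⟩ := exists_abs_KH_le ((le_abs_self _).trans_lt h1)
    ((neg_le_abs _).trans_lt h1) h2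
  have hd : 0 < 1 - 2 * δ := by linarith
  refine ⟨(6 * a + 9 * a ^ 2) * C ^ 2 * (4 / (1 - 2 * δ)), by positivity, ?_⟩
  intro ε hε t ht s hs
  have hε0 := hε.1
  have hm0 : 0 ≤ min s t := le_min hs.1 ht.1
  have hms : min s t ≤ s := min_le_left _ _
  have hmt : min s t ≤ t := min_le_right _ _
  generalize min s t = m at hm0 hms hmt ⊢
  obtain ⟨hgi, hgle⟩ := integral_sq_rpow_add_rpow_le h2 hm0 (hms.trans hs.2)
  obtain ⟨R, hR⟩ : ∃ R : ℝ → ℝ → ℝ, R = fun t s =>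
    ∫ u in s..t, Real.exp (-(a * ε * (t - u))) * KH H u s := ⟨_, rfl⟩
  have hRm : ∀ t, Measurable (R t) := fun t => by
    rw [hR]; exact measurable_integral_exp_mul_KH H (a * ε) t
  have hKm : ∀ t, Measurable (KH H t) := fun t =>
    (measurable_KH H).comp measurable_prodMk_left
  have hmono : ∀ t u, m ≤ t → u ∈ Set.Ioo 0 m →
      u ^ (-δ) + (t - u) ^ (-δ) ≤ u ^ (-δ) + (m - u) ^ (-δ) := fun t u hmt hu => by
    have := Real.rpow_le_rpow_of_nonpos (by linarith [hu.2] : 0 < m - u)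
      (by linarith : m - u ≤ t - u) (by linarith : -δ ≤ 0)
    linarith
  have hKb : ∀ t u, m ≤ t → t ≤ 1 → u ∈ Set.Ioo 0 m →
      |KH H t u| ≤ C * (u ^ (-δ) + (m - u) ^ (-δ)) := fun t u hmt ht hu =>
    (hK u t hu.1 (hu.2.trans_le hmt) ht).trans (by gcongr ?_ * ?_; exact hmono t u hmt hu)
  have hRb : ∀ t u, m ≤ t → t ≤ 1 → u ∈ Set.Ioo 0 m →
      |R t u| ≤ 3 * C * (u ^ (-δ) + (m - u) ^ (-δ)) := fun t u hmt ht hu => by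
    rw [hR]
    exact (abs_integral_exp_mul_KH_le hδ0 h2 hC hK (by positivity) hu.1 (hu.2.trans_le hmt)
      ht).trans (by gcongr ?_ * ?_; exact hmono t u hmt hu)
  have hprod : ∀ (f g : ℝ → ℝ) (A B : ℝ), 0 ≤ A → 0 ≤ B → Measurable f → Measurable g →
      (∀ u ∈ Set.Ioo 0 m, |f u| ≤ A * (u ^ (-δ) + (m - u) ^ (-δ))) →
      (∀ u ∈ Set.Ioo 0 m, |g u| ≤ B * (u ^ (-δ) + (m - u) ^ (-δ))) →
      IntervalIntegrable (fun u => f u * g u) volume 0 m ∧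
        |∫ u in (0:ℝ)..m, f u * g u| ≤ A * B * (4 / (1 - 2 * δ)) := by
    intro f g A B hA hB hf hg hfb hgb
    have hb : ∀ u ∈ Set.Ioo 0 m,
        ‖f u * g u‖ ≤ A * B * (u ^ (-δ) + (m - u) ^ (-δ)) ^ 2 := fun u hu => by
      have hmu : 0 < m - u := by linarith [hu.2]
      have hu0 := hu.1
      rw [norm_mul]
      calc ‖f u‖ * ‖g u‖ ≤ (A * (u ^ (-δ) + (m - u) ^ (-δ))) * (B * (u ^ (-δ) + (m - u) ^ (-δ))) :=
            mul_le_mul (hfb u hu) (hgb u hu) (norm_nonneg _) (by positivity)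
        _ = _ := by ring
    have hdom := hgi.const_mul (A * B)
    have hint : IntervalIntegrable (fun u => f u * g u) volume 0 m := by
      rw [intervalIntegrable_iff_integrableOn_Ioo_of_le hm0] at hdom ⊢
      refine Integrable.mono' hdom (hf.mul hg).aestronglyMeasurable ?_
      filter_upwards [ae_restrict_mem measurableSet_Ioo] with u hu
      exact hb u hu
    refine ⟨hint, (intervalIntegral.abs_integral_le_integral_abs hm0).trans ?_⟩
    refine (intervalIntegral.integral_mono_on_of_le_Ioo hm0 hint.abs hdom hb).trans ?_
    rw [intervalIntegral.integral_const_mul]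
    gcongr
  have h3C : 0 ≤ 3 * C := by positivity
  obtain ⟨iKK, -⟩ := hprod _ _ C C hC hC (hKm t) (hKm s) (fun u => hKb t u hmt ht.2)
    (fun u => hKb s u hms hs.2)
  obtain ⟨iKR, bKR⟩ := hprod _ _ C (3 * C) hC h3C (hKm t) (hRm s) (fun u => hKb t u hmt ht.2)
    (fun u => hRb s u hms hs.2)
  obtain ⟨iRK, bRK⟩ := hprod _ _ (3 * C) C h3C hC (hRm t) (hKm s) (fun u => hRb t u hmt ht.2)
    (fun u => hKb s u hms hs.2)
  obtain ⟨iRR, bRR⟩ := hprod _ _ (3 * C) (3 * C) h3C h3C (hRm t) (hRm s)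
    (fun u => hRb t u hmt ht.2) (fun u => hRb s u hms hs.2)
  have hKeps : ∀ t u, m ≤ t → u ∈ Set.Ioo 0 m →
      KepsFOU H a ε t u = ε ^ H * (KH H t u - a * ε * R t u) := fun t u hmt hu => by
    rw [KepsFOU, if_pos (hu.2.trans_le hmt), hR, Real.rpow_add_one hε0.ne']
    ring
  have hexp : ε ^ (-(2 * H)) * ∫ u in (0:ℝ)..m, KepsFOU H a ε t u * KepsFOU H a ε s u =
      (∫ u in (0:ℝ)..m, KH H t u * KH H s u)
        - a * ε * ((∫ u in (0:ℝ)..m, KH H t u * R s u) + ∫ u in (0:ℝ)..m, R t u * KH H s u)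
        + (a * ε) ^ 2 * ∫ u in (0:ℝ)..m, R t u * R s u := by
    rw [← intervalIntegral.integral_const_mul, ← intervalIntegral.integral_add iKR iRK,
      ← intervalIntegral.integral_const_mul, ← intervalIntegral.integral_const_mul,
      ← intervalIntegral.integral_sub iKK ((iKR.add iRK).const_mul _),
      ← intervalIntegral.integral_add (iKK.sub ((iKR.add iRK).const_mul _)) (iRR.const_mul _)]
    refine intervalIntegral.integral_congr_Ioo_of_le hm0 fun u hu => ?_
    have hpow : ε ^ (-(2 * H)) * (ε ^ H * ε ^ H) = 1 := by
      rw [← Real.rpow_add hε0, ← Real.rpow_add hε0]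
      ring_nf
      exact Real.rpow_zero ε
    simp only [hKeps t u hmt hu, hKeps s u hms hu]
    linear_combination
      ((KH H t u - a * ε * R t u) * (KH H s u - a * ε * R s u)) * hpow
  rw [hexp]
  generalize (∫ u in (0:ℝ)..m, KH H t u * KH H s u) = x₀
  generalize (∫ u in (0:ℝ)..m, KH H t u * R s u) = x₁ at bKR ⊢
  generalize (∫ u in (0:ℝ)..m, R t u * KH H s u) = x₂ at bRK ⊢
  generalize (∫ u in (0:ℝ)..m, R t u * R s u) = x₃ at bRR ⊢
  have hsq : ε ^ 2 ≤ ε := by nlinarith [hε.2]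
  calc |x₀ - (x₀ - a * ε * (x₁ + x₂) + (a * ε) ^ 2 * x₃)|
      = |a * ε * (x₁ + x₂) - (a * ε) ^ 2 * x₃| := by ring_nf
    _ ≤ |a * ε * (x₁ + x₂)| + |(a * ε) ^ 2 * x₃| := abs_sub _ _
    _ = a * ε * |x₁ + x₂| + a ^ 2 * ε ^ 2 * |x₃| := by
      rw [abs_mul (a * ε), abs_mul ((a * ε) ^ 2), abs_of_pos (mul_pos ha hε0),
        abs_of_nonneg (sq_nonneg (a * ε)), mul_pow]
    _ ≤ a * ε * (C * (3 * C) * (4 / (1 - 2 * δ)) + 3 * C * C * (4 / (1 - 2 * δ))) +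
        a ^ 2 * ε * (3 * C * (3 * C) * (4 / (1 - 2 * δ))) := by
      gcongr
      exact (abs_add_le _ _).trans (add_le_add bKR bRK)
    _ = _ := by ring

/-- Condition (K1) for fOU-driven volatility: the normalized covariances of the
rescaled fOU process converge, uniformly for `s, t ∈ [0,1]`, to the covariance of
the fractional Brownian motion, as `ε → 0⁺`. -/
theorem stmt_8 (H a : ℝ) (hH : H ∈ Set.Ioo (0:ℝ) 1) (ha : 0 < a) :
    TendstoUniformlyOn
      (fun ε : ℝ => fun ts : ℝ × ℝ =>
        ε ^ (-(2 * H)) * ∫ u in (0:ℝ)..(min ts.2 ts.1), KepsFOU H a ε ts.1 u * KepsFOU H a ε ts.2 u)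
      (fun ts : ℝ × ℝ => ∫ u in (0:ℝ)..(min ts.2 ts.1), KH H ts.1 u * KH H ts.2 u)
      (nhdsWithin 0 (Set.Ioc 0 1))
      (Set.Icc 0 1 ×ˢ Set.Icc 0 1) := by
  obtain ⟨M, hM, hb⟩ := exists_abs_covariance_sub_le hH ha
  rw [Metric.tendstoUniformlyOn_iff]
  intro η hη
  have hlt : ∀ᶠ ε in nhdsWithin (0:ℝ) (Set.Ioc 0 1), M * ε < η := by
    have hc : Tendsto (fun ε : ℝ => M * ε) (nhdsWithin 0 (Set.Ioc 0 1)) (nhds (M * 0)) :=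
      (continuous_const.mul continuous_id).continuousAt.tendsto.mono_left nhdsWithin_le_nhds
    exact hc.eventually_lt_const (by simpa using hη)
  filter_upwards [hlt, self_mem_nhdsWithin] with ε hε hmem ts hts
  rw [Real.dist_eq]
  exact (hb ε hmem ts.1 hts.1 ts.2 hts.2).trans_lt hε
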